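/- Consider matrices N_J ∈ ℝ^{n_J×n_E} and N_A ∈ ℝ^{n_A×n_E}, symmetric positive definite matrices Λ_q ∈ ℝ^{n_E×n_E} and A^A ∈ ℝ^{n_A×n_A}, and a diagonal matrix K ∈ ℝ^{n_E×n_E} with strictly positive diagonal entries. Suppose the linear map (x, w) ↦ N_Jᵀ x + N_Aᵀ w from ℝ^{n_J} × ℝ^{n_A} to ℝ^{n_E} is injective. Let q : [0, ∞) → ℝ^{n_E}, p^J : [0, ∞) → ℝ^{n_J}, p^A : [0, ∞) → ℝ^{n_A} be a consistent unforced trajectory, i.e., q and p^A are differentiable, p^J is continuous, and for all t ≥ 0: Λ_q q'(t) = N_Jᵀ p^J(t) + N_Aᵀ p^A(t) − K q(t), N_J q(t) = 0, and A^A (p^A)'(t) = −N_A q(t). Then q(t) → 0, p^J(t) → 0, and p^A(t) → 0 as t → ∞. -/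

import Mathlib

open Set Matrix Filter

/-- A function on `[0, ∞)` satisfying `V' ≤ -c V` with `c > 0` is bounded by `V 0 * exp (-c t)`. -/
theorem le_mul_exp_of_hasDerivWithinAt_le {V V' : ℝ → ℝ} {c : ℝ}
    (hV : ∀ t ∈ Ici (0 : ℝ), HasDerivWithinAt V (V' t) (Ici 0) t)
    (hle : ∀ t ∈ Ici (0 : ℝ), V' t ≤ -c * V t) {t : ℝ} (ht : 0 ≤ t) :
    V t ≤ V 0 * Real.exp (-c * t) := by
  have hd : ∀ s ∈ Ici (0 : ℝ), HasDerivWithinAt (fun s => V s * Real.exp (c * s))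
      (V' s * Real.exp (c * s) + V s * (Real.exp (c * s) * (c * 1))) (Ici 0) s := fun s hs =>
    (hV s hs).mul (((hasDerivAt_id s).const_mul c).exp.hasDerivWithinAt)
  have hanti : AntitoneOn (fun s => V s * Real.exp (c * s)) (Ici 0) := by
    refine antitoneOn_of_hasDerivWithinAt_nonpos (convex_Ici 0)
      (fun s hs => (hd s hs).continuousWithinAt)
      (fun s hs => (hd s (interior_subset hs)).mono interior_subset) fun s hs => ?_
    have h1 := hle s (interior_subset hs)
    nlinarith [Real.exp_pos (c * s)]
  have h := hanti (mem_Ici.2 le_rfl) (mem_Ici.2 ht) ht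
  simp only [mul_zero, Real.exp_zero, mul_one] at h
  rw [neg_mul, Real.exp_neg, ← div_eq_mul_inv, le_div_iff₀ (Real.exp_pos _)]
  exact h

/-- Decay from an energy `E` dissipating only in `x`, and a cross term `W` dissipating in `y`. -/
theorem tendsto_sq_add_sq_of_dissipation {E E' W W' x y : ℝ → ℝ} {m M c k g C : ℝ}
    (hm : 0 < m) (hk : 0 < k) (hg : 0 < g)
    (hE : ∀ t ∈ Ici (0 : ℝ), HasDerivWithinAt E (E' t) (Ici 0) t)
    (hW : ∀ t ∈ Ici (0 : ℝ), HasDerivWithinAt W (W' t) (Ici 0) t)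
    (hEm : ∀ t, m * (x t ^ 2 + y t ^ 2) ≤ E t) (hEM : ∀ t, E t ≤ M * (x t ^ 2 + y t ^ 2))
    (hWc : ∀ t, |W t| ≤ c * (x t ^ 2 + y t ^ 2))
    (hE' : ∀ t ∈ Ici (0 : ℝ), E' t ≤ -k * x t ^ 2)
    (hW' : ∀ t ∈ Ici (0 : ℝ), W' t ≤ -g * y t ^ 2 + C * x t ^ 2) :
    Tendsto (fun t => x t ^ 2 + y t ^ 2) atTop (nhds 0) := by
  obtain ⟨N, hN0, hNm, hNk⟩ : ∃ N : ℝ, 0 < N ∧ c + 1 ≤ N * m ∧ C + g ≤ N * k := by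
    refine ⟨max 1 (max ((c + 1) / m) ((C + g) / k)), by positivity, ?_, ?_⟩
    · rw [← div_le_iff₀ hm]; exact (le_max_left _ _).trans (le_max_right _ _)
    · rw [← div_le_iff₀ hk]; exact (le_max_right _ _).trans (le_max_right _ _)
  obtain ⟨D, hD0, hD⟩ : ∃ D : ℝ, 0 < D ∧ N * M + c ≤ D :=
    ⟨max 1 (N * M + c), by positivity, le_max_right _ _⟩
  have hr : ∀ t, 0 ≤ x t ^ 2 + y t ^ 2 := fun t => by positivity
  have hlow : ∀ t, x t ^ 2 + y t ^ 2 ≤ N * E t + W t := fun t => by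
    have h1 := mul_le_mul_of_nonneg_left (hEm t) hN0.le
    have h2 := mul_le_mul_of_nonneg_right hNm (hr t)
    have h3 := (abs_le.1 (hWc t)).1
    linarith
  have hup : ∀ t, N * E t + W t ≤ D * (x t ^ 2 + y t ^ 2) := fun t => by
    have h1 := mul_le_mul_of_nonneg_left (hEM t) hN0.le
    have h2 := mul_le_mul_of_nonneg_right hD (hr t)
    have h3 := (abs_le.1 (hWc t)).2
    linarith
  have hle : ∀ t ∈ Ici (0 : ℝ), N * E' t + W' t ≤ -(g / D) * (N * E t + W t) := fun t ht => by
    have h1 := mul_le_mul_of_nonneg_left (hE' t ht) hN0.le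
    have h2 := mul_le_mul_of_nonneg_right hNk (sq_nonneg (x t))
    have h3 := mul_le_mul_of_nonneg_left (hup t) (div_nonneg hg.le hD0.le)
    have h4 : g / D * (D * (x t ^ 2 + y t ^ 2)) = g * (x t ^ 2 + y t ^ 2) := by field_simp
    linarith [hW' t ht]
  have hlim : Tendsto (fun t => (N * E 0 + W 0) * Real.exp (-(g / D) * t)) atTop (nhds 0) := by
    have h : Tendsto (fun t : ℝ => -(g / D) * t) atTop atBot :=
      tendsto_id.const_mul_atTop_of_neg (neg_lt_zero.2 (div_pos hg hD0))
    simpa using (Real.tendsto_exp_atBot.comp h).const_mul (N * E 0 + W 0)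
  refine tendsto_of_tendsto_of_tendsto_of_le_of_le' tendsto_const_nhds hlim
    (Eventually.of_forall hr) ((eventually_ge_atTop 0).mono fun t ht => ?_)
  exact (hlow t).trans (le_mul_exp_of_hasDerivWithinAt_le (V := fun t => N * E t + W t)
    (fun s hs => ((hE s hs).const_mul N).add (hW s hs)) hle ht)

theorem Matrix.PosDef.exists_mul_sq_norm_le {n : Type*} [Fintype n] {M : Matrix n n ℝ}
    (hM : M.PosDef) : ∃ m > 0, ∀ x : n → ℝ, m * ‖x‖ ^ 2 ≤ x ⬝ᵥ M *ᵥ x := by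
  have hcont : Continuous fun x : n → ℝ => x ⬝ᵥ M *ᵥ x :=
    continuous_id.dotProduct (continuous_const.matrix_mulVec continuous_id)
  obtain hemp | hne := (Metric.sphere (0 : n → ℝ) 1).eq_empty_or_nonempty
  · refine ⟨1, one_pos, fun x => ?_⟩
    by_cases hx : x = 0
    · simp [hx]
    · have : ‖x‖⁻¹ • x ∈ Metric.sphere (0 : n → ℝ) 1 := by
        simp [norm_smul, hx]
      simp [hemp] at this
  · obtain ⟨z, hz, hmin⟩ := (isCompact_sphere (0 : n → ℝ) 1).exists_isMinOn hne hcont.continuousOn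
    have hz0 : z ≠ 0 := fun h => by simp [h] at hz
    refine ⟨z ⬝ᵥ M *ᵥ z, by simpa using hM.dotProduct_mulVec_pos hz0, fun x => ?_⟩
    by_cases hx : x = 0
    · simp [hx]
    have hmem : ‖x‖⁻¹ • x ∈ Metric.sphere (0 : n → ℝ) 1 := by simp [norm_smul, hx]
    have h : z ⬝ᵥ M *ᵥ z ≤ _ := hmin hmem
    simp only [mulVec_smul, smul_dotProduct, dotProduct_smul, smul_eq_mul] at h
    have hx' : 0 < ‖x‖ := norm_pos_iff.2 hx
    calc z ⬝ᵥ M *ᵥ z * ‖x‖ ^ 2 ≤ ‖x‖⁻¹ * (‖x‖⁻¹ * x ⬝ᵥ M *ᵥ x) * ‖x‖ ^ 2 := by gcongr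
      _ = x ⬝ᵥ M *ᵥ x := by field_simp

theorem Matrix.exists_abs_dotProduct_mulVec_le {m n : Type*} [Fintype m] [Fintype n]
    (M : Matrix m n ℝ) : ∃ C ≥ 0, ∀ x y, |x ⬝ᵥ M *ᵥ y| ≤ C * ‖x‖ * ‖y‖ := by
  refine ⟨∑ i, ∑ j, |M i j|, by positivity, fun x y => ?_⟩
  simp only [dotProduct, mulVec, Finset.mul_sum, Finset.sum_mul]
  refine (Finset.abs_sum_le_sum_abs _ _).trans (Finset.sum_le_sum fun i _ =>
    (Finset.abs_sum_le_sum_abs _ _).trans (Finset.sum_le_sum fun j _ => ?_))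
  rw [abs_mul, abs_mul]
  calc |x i| * (|M i j| * |y j|) ≤ ‖x‖ * (|M i j| * ‖y‖) := by
        gcongr
        exacts [norm_le_pi_norm x i, norm_le_pi_norm y j]
    _ = |M i j| * ‖x‖ * ‖y‖ := by ring

theorem HasDerivWithinAt.matrix_mulVec {m n : Type*} [Fintype m] [Fintype n] (M : Matrix m n ℝ)
    {u : ℝ → n → ℝ} {u' : n → ℝ} {s : Set ℝ} {t : ℝ} (hu : HasDerivWithinAt u u' s t) :
    HasDerivWithinAt (fun t => M *ᵥ u t) (M *ᵥ u') s t :=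
  M.mulVecLin.toContinuousLinearMap.hasFDerivAt.comp_hasDerivWithinAt t hu

theorem HasDerivWithinAt.dotProduct {n : Type*} [Fintype n] {u v : ℝ → n → ℝ} {u' v' : n → ℝ}
    {s : Set ℝ} {t : ℝ} (hu : HasDerivWithinAt u u' s t) (hv : HasDerivWithinAt v v' s t) :
    HasDerivWithinAt (fun t => u t ⬝ᵥ v t) (u' ⬝ᵥ v t + u t ⬝ᵥ v') s t := by
  simp only [_root_.dotProduct, ← Finset.sum_add_distrib]
  exact HasDerivWithinAt.fun_sum fun i _ =>
    (hasDerivWithinAt_pi.1 hu i).mul (hasDerivWithinAt_pi.1 hv i)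

theorem Matrix.IsHermitian.dotProduct_mulVec_comm {n : Type*} [Fintype n] {M : Matrix n n ℝ}
    (hM : M.IsHermitian) (x y : n → ℝ) : x ⬝ᵥ M *ᵥ y = y ⬝ᵥ M *ᵥ x := by
  rw [dotProduct_mulVec, ← mulVec_transpose, ← conjTranspose_eq_transpose_of_trivial, hM.eq,
    dotProduct_comm]

/-- Asymptotic stability of `q' = G p + F q`, `p' = H q` with `G` injective, when the energy
`q ⬝ Λ q + p ⬝ A p` is dissipated at rate `2 q ⬝ K q`. -/
theorem tendsto_zero_of_partial_dissipation {m n : Type*} [Fintype m] [Fintype n]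
    {Λ K F : Matrix n n ℝ} {A : Matrix m m ℝ} {G : Matrix n m ℝ} {H : Matrix m n ℝ}
    (hΛ : Λ.PosDef) (hA : A.PosDef) (hK : K.PosDef) (hG : Function.Injective G.mulVec)
    {q q' : ℝ → n → ℝ} {p p' : ℝ → m → ℝ}
    (hq : ∀ t ∈ Ici (0 : ℝ), HasDerivWithinAt q (q' t) (Ici 0) t)
    (hp : ∀ t ∈ Ici (0 : ℝ), HasDerivWithinAt p (p' t) (Ici 0) t)
    (hq' : ∀ t ∈ Ici (0 : ℝ), q' t = G *ᵥ p t + F *ᵥ q t)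
    (hp' : ∀ t ∈ Ici (0 : ℝ), p' t = H *ᵥ q t)
    (hdiss : ∀ t ∈ Ici (0 : ℝ),
      q t ⬝ᵥ Λ *ᵥ q' t + p t ⬝ᵥ A *ᵥ p' t = -(q t ⬝ᵥ K *ᵥ q t)) :
    Tendsto q atTop (nhds 0) ∧ Tendsto p atTop (nhds 0) := by
  have hGG : (Gᵀ * G).PosDef := by
    simpa using PosDef.conjTranspose_mul_self G hG
  obtain ⟨m₁, hm₁, hm₁'⟩ := hΛ.exists_mul_sq_norm_le
  obtain ⟨m₂, hm₂, hm₂'⟩ := hA.exists_mul_sq_norm_le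
  obtain ⟨k, hk, hk'⟩ := hK.exists_mul_sq_norm_le
  obtain ⟨g, hg, hg'⟩ := hGG.exists_mul_sq_norm_le
  obtain ⟨M₁, hM₁, hM₁'⟩ := exists_abs_dotProduct_mulVec_le Λ
  obtain ⟨M₂, hM₂, hM₂'⟩ := exists_abs_dotProduct_mulVec_le A
  obtain ⟨c, hc, hc'⟩ := exists_abs_dotProduct_mulVec_le G
  obtain ⟨c₁, hc₁, hc₁'⟩ := exists_abs_dotProduct_mulVec_le (Fᵀ * G)
  obtain ⟨c₂, hc₂, hc₂'⟩ := exists_abs_dotProduct_mulVec_le (G * H)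
  have hsum : Tendsto (fun t => ‖q t‖ ^ 2 + ‖p t‖ ^ 2) atTop (nhds 0) := by
    refine tendsto_sq_add_sq_of_dissipation (x := fun t => ‖q t‖) (y := fun t => ‖p t‖)
      (E := fun t => q t ⬝ᵥ Λ *ᵥ q t + p t ⬝ᵥ A *ᵥ p t) (W := fun t => -(q t ⬝ᵥ G *ᵥ p t))
      (m := min m₁ m₂) (M := M₁ + M₂) (c := c) (k := 2 * k) (g := g / 2)
      (C := c₁ ^ 2 / (2 * g) + c₂) (lt_min hm₁ hm₂) (by positivity) (by positivity)
      (fun t ht => ((hq t ht).dotProduct ((hq t ht).matrix_mulVec Λ)).add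
        ((hp t ht).dotProduct ((hp t ht).matrix_mulVec A)))
      (fun t ht => ((hq t ht).dotProduct ((hp t ht).matrix_mulVec G)).neg)
      (fun t => ?_) (fun t => ?_) (fun t => ?_) (fun t ht => ?_) (fun t ht => ?_)
    · have h1 := mul_le_mul_of_nonneg_right (min_le_left m₁ m₂) (sq_nonneg ‖q t‖)
      have h2 := mul_le_mul_of_nonneg_right (min_le_right m₁ m₂) (sq_nonneg ‖p t‖)
      linarith [hm₁' (q t), hm₂' (p t)]
    · have h1 := (abs_le.1 (hM₁' (q t) (q t))).2
      have h2 := (abs_le.1 (hM₂' (p t) (p t))).2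
      nlinarith [mul_nonneg hM₁ (sq_nonneg ‖p t‖), mul_nonneg hM₂ (sq_nonneg ‖q t‖)]
    · rw [abs_neg]
      have h2 : ‖q t‖ * ‖p t‖ ≤ ‖q t‖ ^ 2 + ‖p t‖ ^ 2 := by
        nlinarith [sq_nonneg (‖q t‖ - ‖p t‖), sq_nonneg ‖q t‖, sq_nonneg ‖p t‖]
      have h3 := mul_le_mul_of_nonneg_left h2 hc
      linarith [hc' (q t) (p t)]
    · have h1 := hΛ.isHermitian.dotProduct_mulVec_comm (q' t) (q t)
      have h2 := hA.isHermitian.dotProduct_mulVec_comm (p' t) (p t)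
      linarith [hdiss t ht, hk' (q t)]
    · have h1 : (q' t) ⬝ᵥ G *ᵥ p t
          = p t ⬝ᵥ (Gᵀ * G) *ᵥ p t + q t ⬝ᵥ (Fᵀ * G) *ᵥ p t := by
        rw [hq' t ht, add_dotProduct]
        simp only [← mulVec_mulVec, dotProduct_mulVec _ Gᵀ, dotProduct_mulVec _ Fᵀ,
          vecMul_transpose]
      have h2 : q t ⬝ᵥ G *ᵥ p' t = q t ⬝ᵥ (G * H) *ᵥ q t := by
        rw [hp' t ht, mulVec_mulVec]
      have h3 := (abs_le.1 (hc₁' (q t) (p t))).1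
      have h4 := (abs_le.1 (hc₂' (q t) (q t))).1
      have h5 : c₁ * ‖q t‖ * ‖p t‖ ≤ g / 2 * ‖p t‖ ^ 2 + c₁ ^ 2 / (2 * g) * ‖q t‖ ^ 2 := by
        have h6 : g / 2 * ‖p t‖ ^ 2 + c₁ ^ 2 / (2 * g) * ‖q t‖ ^ 2 - c₁ * ‖q t‖ * ‖p t‖
            = (g * ‖p t‖ - c₁ * ‖q t‖) ^ 2 / (2 * g) := by field_simp; ring
        have h7 : 0 ≤ (g * ‖p t‖ - c₁ * ‖q t‖) ^ 2 / (2 * g) := by positivity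
        linarith
      rw [h1, h2]
      linarith [hg' (p t)]
  have key : ∀ {x : ℝ → ℝ}, (∀ t, 0 ≤ x t) → (∀ t, x t ^ 2 ≤ ‖q t‖ ^ 2 + ‖p t‖ ^ 2) →
      Tendsto x atTop (nhds 0) := fun {x} hx hle => by
    have h := squeeze_zero (fun t => sq_nonneg (x t)) hle hsum
    have h' := (Real.continuous_sqrt.tendsto 0).comp h
    simpa [Function.comp_def, Real.sqrt_sq (hx _)] using h'
  exact ⟨tendsto_zero_iff_norm_tendsto_zero.2 (key (fun t => norm_nonneg _) fun t => by
      linarith [sq_nonneg ‖p t‖]), tendsto_zero_iff_norm_tendsto_zero.2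
      (key (fun t => norm_nonneg _) fun t => by linarith [sq_nonneg ‖q t‖])⟩

/-- Asymptotic stability of the linearized hydraulic DAE.  With positive
definite inertance `Λ_q` and tank-area `A^A` matrices, positive link slopes `K`, and an
injective non-reservoir incidence map, every consistent unforced trajectory on `[0, ∞)`
decays to the origin: `q(t) → 0`, `p^J(t) → 0`, `p^A(t) → 0` as `t → ∞`. -/
theorem linearized_dae_asymptotic_stability
    (nJ nA nE : ℕ)
    (NJ : Matrix (Fin nJ) (Fin nE) ℝ) (NA : Matrix (Fin nA) (Fin nE) ℝ)
    (Λq : Matrix (Fin nE) (Fin nE) ℝ) (AA : Matrix (Fin nA) (Fin nA) ℝ)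
    (hΛq : Λq.PosDef) (hAA : AA.PosDef)
    (κ : Fin nE → ℝ) (hκ : ∀ e, 0 < κ e)
    (K : Matrix (Fin nE) (Fin nE) ℝ) (hK : K = Matrix.diagonal κ)
    (hinj : Function.Injective
      (fun xw : (Fin nJ → ℝ) × (Fin nA → ℝ) => NJᵀ *ᵥ xw.1 + NAᵀ *ᵥ xw.2))
    (q q' : ℝ → Fin nE → ℝ) (pJ : ℝ → Fin nJ → ℝ) (pA pA' : ℝ → Fin nA → ℝ)
    (hq : ∀ t ∈ Ici (0 : ℝ), HasDerivWithinAt q (q' t) (Ici (0 : ℝ)) t)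
    (hpA : ∀ t ∈ Ici (0 : ℝ), HasDerivWithinAt pA (pA' t) (Ici (0 : ℝ)) t)
    (hpJ : ContinuousOn pJ (Ici (0 : ℝ)))
    (hlink : ∀ t ∈ Ici (0 : ℝ), Λq *ᵥ q' t = NJᵀ *ᵥ pJ t + NAᵀ *ᵥ pA t - K *ᵥ q t)
    (hjunction : ∀ t ∈ Ici (0 : ℝ), NJ *ᵥ q t = 0)
    (htank : ∀ t ∈ Ici (0 : ℝ), AA *ᵥ pA' t = -(NA *ᵥ q t)) :
    Tendsto q atTop (nhds 0) ∧ Tendsto pJ atTop (nhds 0) ∧ Tendsto pA atTop (nhds 0) := by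
  have hKpos : K.PosDef := hK ▸ PosDef.diagonal hκ
  have hΛdet : IsUnit Λq.det := hΛq.det_pos.ne'.isUnit
  have hAdet : IsUnit AA.det := hAA.det_pos.ne'.isUnit
  have hNJinj : Function.Injective NJᵀ.mulVec := fun x y hxy => by
    have h := @hinj (x, 0) (y, 0) (by simpa using hxy)
    exact congrArg Prod.fst h
  set S := NJ * Λq⁻¹ * NJᵀ with hS
  have hSpos : S.PosDef := by
    simpa using hΛq.inv.conjTranspose_mul_mul_same (B := NJᵀ) hNJinj
  have hSdet : IsUnit S.det := hSpos.det_pos.ne'.isUnit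
  set L₁ := S⁻¹ * (NJ * Λq⁻¹ * K) with hL₁
  set L₂ := -(S⁻¹ * (NJ * Λq⁻¹ * NAᵀ)) with hL₂
  set G := Λq⁻¹ * (NJᵀ * L₂ + NAᵀ) with hGdef
  have hq'_eq : ∀ t ∈ Ici (0 : ℝ), q' t = Λq⁻¹ *ᵥ (NJᵀ *ᵥ pJ t + NAᵀ *ᵥ pA t - K *ᵥ q t) :=
    fun t ht => by
      rw [← hlink t ht, mulVec_mulVec, nonsing_inv_mul _ hΛdet, one_mulVec]
  have hNJq' : ∀ t ∈ Ici (0 : ℝ), NJ *ᵥ q' t = 0 := fun t ht => by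
    have h0 : HasDerivWithinAt (fun t => NJ *ᵥ q t) 0 (Ici 0) t :=
      (hasDerivWithinAt_const t (Ici (0 : ℝ)) 0).congr hjunction (hjunction t ht)
    exact (uniqueDiffOn_Ici (0 : ℝ) t ht).eq_deriv _ ((hq t ht).matrix_mulVec NJ) h0
  have hpJ_eq : ∀ t ∈ Ici (0 : ℝ), pJ t = L₁ *ᵥ q t + L₂ *ᵥ pA t := fun t ht => by
    have h := hNJq' t ht
    rw [hq'_eq t ht] at h
    simp only [mulVec_sub, mulVec_add, mulVec_mulVec, ← Matrix.mul_assoc] at h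
    have hSp : S *ᵥ pJ t = (NJ * Λq⁻¹ * K) *ᵥ q t - (NJ * Λq⁻¹ * NAᵀ) *ᵥ pA t := by
      rw [sub_eq_zero] at h
      exact eq_sub_of_add_eq h
    calc pJ t = S⁻¹ *ᵥ (S *ᵥ pJ t) := by
          rw [mulVec_mulVec, nonsing_inv_mul _ hSdet, one_mulVec]
      _ = _ := by
          rw [hSp, mulVec_sub, mulVec_mulVec, mulVec_mulVec, hL₁, hL₂, neg_mulVec, sub_eq_add_neg]
  have hGinj : Function.Injective G.mulVec := by
    have hker : ∀ w, G *ᵥ w = 0 → w = 0 := fun w hw => by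
      have h1 : Λq *ᵥ (G *ᵥ w) = NJᵀ *ᵥ (L₂ *ᵥ w) + NAᵀ *ᵥ w := by
        rw [hGdef, mulVec_mulVec, mul_nonsing_inv_cancel_left _ _ hΛdet, add_mulVec,
          mulVec_mulVec]
      rw [hw, mulVec_zero] at h1
      have h := @hinj (L₂ *ᵥ w, w) (0, 0) (by simpa using h1.symm)
      exact congrArg Prod.snd h
    intro x y hxy
    exact sub_eq_zero.1 (hker _ (by rw [mulVec_sub]; exact sub_eq_zero.2 hxy))
  obtain ⟨hq0, hpA0⟩ := tendsto_zero_of_partial_dissipation (F := Λq⁻¹ * (NJᵀ * L₁ - K))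
    (H := -(AA⁻¹ * NA)) hΛq hAA hKpos hGinj hq hpA
    (fun t ht => by
      rw [hq'_eq t ht, hpJ_eq t ht, hGdef]
      simp only [mulVec_add, mulVec_sub, add_mulVec, sub_mulVec, Matrix.mul_add, Matrix.mul_sub,
        mulVec_mulVec]
      abel)
    (fun t ht => by
      rw [neg_mulVec, ← mulVec_mulVec, ← mulVec_neg, ← htank t ht, mulVec_mulVec,
        nonsing_inv_mul _ hAdet, one_mulVec])
    (fun t ht => by
      rw [hlink t ht, htank t ht, dotProduct_sub, dotProduct_add, dotProduct_neg,
        dotProduct_mulVec _ NJᵀ, dotProduct_mulVec _ NAᵀ, vecMul_transpose, vecMul_transpose,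
        hjunction t ht, zero_dotProduct, dotProduct_comm (NA *ᵥ q t)]
      ring)
  refine ⟨hq0, ?_, hpA0⟩
  have hlin : Tendsto (fun t => L₁ *ᵥ q t + L₂ *ᵥ pA t) atTop (nhds 0) := by
    have hcont : Continuous fun z : (Fin nE → ℝ) × (Fin nA → ℝ) => L₁ *ᵥ z.1 + L₂ *ᵥ z.2 :=
      (continuous_const.matrix_mulVec continuous_fst).add
        (continuous_const.matrix_mulVec continuous_snd)
    simpa [Function.comp_def] using (hcont.tendsto (0, 0)).comp (hq0.prodMk_nhds hpA0)
  exact hlin.congr' ((eventually_ge_atTop 0).mono fun t ht => (hpJ_eq t ht).symm)
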